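/- Let μ be a product probability measure on the unit cube [0,1]^n whose coordinate marginals have means m_k and variances σ_k² with σ_k² > σ_0² > 0 for all k, let x̄ = (m_1,…,m_n), R_0² = Σ_k σ_k², let x_1, …, x_M be i.i.d. random points with law μ, and let 0 < ϑ < 1. If (M+1)² < (1/3)·ϑ·exp(0.5·n·σ_0⁴), then with probability greater than 1 − ϑ both 1/2 ≤ ‖x_j − x̄‖²/R_0² ≤ 3/2 for all j and ((x_i − x̄)/R_0, (x_j − x̄)/‖x_j − x̄‖) < √2/2 for all i ≠ j; in particular, under this condition the set {x_1, …, x_M} is linearly separable with probability greater than 1 − ϑ. -/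

import Mathlib

open MeasureTheory ProbabilityTheory

/-- A set `S ⊆ ℝⁿ` is linearly separable if each `x ∈ S` can be strictly separated from the
rest of `S` by a linear functional. -/
def LinearlySeparable {n : ℕ} (S : Set (Fin n → ℝ)) : Prop :=
  ∀ x ∈ S, ∃ l : (Fin n → ℝ) →ₗ[ℝ] ℝ, ∀ y ∈ S, y ≠ x → l y < l x

/-- **Hoeffding's inequality** on a finite product of probability spaces, for a sum of functions of
the coordinates, each with values in an interval of length one. -/
theorem measureReal_pi_sum_ge_le {ι : Type*} [Fintype ι] {Ω : ι → Type*}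
    [∀ i, MeasurableSpace (Ω i)] (ρ : ∀ i, Measure (Ω i)) [∀ i, IsProbabilityMeasure (ρ i)]
    (f : ∀ i, Ω i → ℝ) (hf : ∀ i, Measurable (f i)) (a e : ι → ℝ)
    (hb : ∀ i, ∀ᵐ t ∂(ρ i), f i t ∈ Set.Icc (a i) (a i + 1)) (he : ∀ i, e i = ∫ t, f i t ∂(ρ i))
    {ε : ℝ} (hε : 0 ≤ ε) :
    (Measure.pi ρ).real {x | ε ≤ ∑ i, (f i (x i) - e i)} ≤
      Real.exp (-(2 * ε ^ 2 / Fintype.card ι)) := by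
  have hind : iIndepFun (fun i (x : ∀ i, Ω i) => f i (x i) - e i) (Measure.pi ρ) :=
    iIndepFun_pi (X := fun i t => f i t - e i) fun i => ((hf i).sub_const _).aemeasurable
  have hsub : ∀ i ∈ Finset.univ,
      HasSubgaussianMGF (fun x : ∀ i, Ω i => f i (x i) - e i) (1 / 4) (Measure.pi ρ) := by
    intro i _
    have hmp := measurePreserving_eval ρ i
    have h1 := hasSubgaussianMGF_of_mem_Icc (hf i).aemeasurable (hb i)
    rw [← he i, ← hmp.map_eq] at h1
    have h2 := h1.of_map hmp.measurable.aemeasurable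
    have hc : (‖a i + 1 - a i‖₊ / 2) ^ 2 = (1 / 4 : NNReal) := by
      rw [add_sub_cancel_left, nnnorm_one]; norm_num
    rwa [hc] at h2
  refine (HasSubgaussianMGF.measure_sum_ge_le_of_iIndepFun hind hsub hε).trans_eq ?_
  congr 1
  simp only [Finset.sum_const, Finset.card_univ, nsmul_eq_mul]
  push_cast
  rcases eq_or_ne (Fintype.card ι : ℝ) 0 with h0 | h0
  · simp [h0]
  · field_simp
    norm_num

/-- The first two moments determine tail bounds for the squared distance of a random point of the
cube to its mean. -/
theorem measureReal_pi_sum_sq_sub_ge_le {n : ℕ} (ν : Fin n → Measure ℝ)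
    [∀ k, IsProbabilityMeasure (ν k)] (hsupp : ∀ k, ∀ᵐ t ∂(ν k), t ∈ Set.Icc (0 : ℝ) 1)
    (m : Fin n → ℝ) (hm : ∀ k, m k ∈ Set.Icc (0 : ℝ) 1)
    (σ2 : Fin n → ℝ) (hσ2 : ∀ k, σ2 k = ∫ t, (t - m k) ^ 2 ∂(ν k)) {ε : ℝ} (hε : 0 ≤ ε) :
    (Measure.pi ν).real {x | ε ≤ ∑ k, (x k - m k) ^ 2 - ∑ k, σ2 k} ≤
        Real.exp (-(2 * ε ^ 2 / n)) ∧
      (Measure.pi ν).real {x | ε ≤ ∑ k, σ2 k - ∑ k, (x k - m k) ^ 2} ≤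
        Real.exp (-(2 * ε ^ 2 / n)) := by
  have hsq : ∀ k, ∀ᵐ t ∂(ν k), 0 ≤ (t - m k) ^ 2 ∧ (t - m k) ^ 2 ≤ 1 := by
    intro k
    filter_upwards [hsupp k] with t ht
    exact ⟨sq_nonneg _, by
      rw [sq_le_one_iff_abs_le_one, abs_le]
      constructor <;> linarith [(hm k).1, (hm k).2, ht.1, ht.2]⟩
  constructor
  · have h := measureReal_pi_sum_ge_le ν (fun k t => (t - m k) ^ 2) (fun k => by fun_prop)
      (fun _ => 0) σ2 (fun k => by simpa using hsq k) hσ2 hε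
    simpa [Finset.sum_sub_distrib] using h
  · have h := measureReal_pi_sum_ge_le ν (fun k t => -(t - m k) ^ 2) (fun k => by fun_prop)
      (fun _ => -1) (fun k => -σ2 k)
      (fun k => by
        filter_upwards [hsq k] with t ht
        exact ⟨by linarith [ht.2], by linarith [ht.1]⟩)
      (fun k => by rw [integral_neg, hσ2]) hε
    have heq : ∀ x : Fin n → ℝ, ∑ k, (-(x k - m k) ^ 2 - -σ2 k) =
        ∑ k, σ2 k - ∑ k, (x k - m k) ^ 2 := fun x => by
      rw [← Finset.sum_sub_distrib]
      exact Finset.sum_congr rfl fun k _ => by ring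
    simpa only [heq, Fintype.card_fin] using h

/-- Tail bound for the inner product of two independent centred random points of the cube. -/
theorem measureReal_prod_sum_mul_ge_le {n : ℕ} (ν : Fin n → Measure ℝ)
    [∀ k, IsProbabilityMeasure (ν k)] (hsupp : ∀ k, ∀ᵐ t ∂(ν k), t ∈ Set.Icc (0 : ℝ) 1)
    (m : Fin n → ℝ) (hm : ∀ k, m k = ∫ t, t ∂(ν k)) (hm01 : ∀ k, m k ∈ Set.Icc (0 : ℝ) 1)
    {ε : ℝ} (hε : 0 ≤ ε) :
    ((Measure.pi ν).prod (Measure.pi ν)).real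
        {p | ε ≤ ∑ k, (p.1 k - m k) * (p.2 k - m k)} ≤ Real.exp (-(2 * ε ^ 2 / n)) := by
  have hcen : ∀ k, ∫ t, (t - m k) ∂(ν k) = 0 := fun k => by
    have hint : Integrable (fun t : ℝ => t) (ν k) :=
      Integrable.of_mem_Icc 0 1 aemeasurable_id (hsupp k)
    rw [integral_sub hint (integrable_const _), ← hm k]
    simp
  have h := measureReal_pi_sum_ge_le (fun k => (ν k).prod (ν k))
    (fun k (t : ℝ × ℝ) => (t.1 - m k) * (t.2 - m k)) (fun k => by fun_prop)
    (fun k => -(m k * (1 - m k))) (fun _ => 0)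
    (fun k => by
      have h1 := (Measure.quasiMeasurePreserving_fst (μ := ν k) (ν := ν k)).ae (hsupp k)
      have h2 := (Measure.quasiMeasurePreserving_snd (μ := ν k) (ν := ν k)).ae (hsupp k)
      filter_upwards [h1, h2] with t ⟨ht0, ht1⟩ ⟨hs0, hs1⟩
      obtain ⟨hm0, hm1⟩ := hm01 k
      have hts := mul_nonneg ht0 hs0
      have hts' := mul_nonneg (sub_nonneg.2 ht1) (sub_nonneg.2 hs1)
      have hle : t.1 * t.2 ≤ 1 := mul_le_one₀ ht1 hs0 hs1
      have hle' : (1 - t.1) * (1 - t.2) ≤ 1 :=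
        mul_le_one₀ (by linarith) (by linarith) (by linarith)
      constructor
      · linarith [mul_nonneg hm0 hts', mul_nonneg (sub_nonneg.2 hm1) hts]
      · linarith [mul_nonneg hm0 (sub_nonneg.2 hle'),
          mul_nonneg (sub_nonneg.2 hm1) (sub_nonneg.2 hle)])
    (fun k => by
      rw [integral_prod_mul (fun t => t - m k) (fun t => t - m k), hcen k, zero_mul]) hε
  rw [← (measurePreserving_arrowProdEquivProdArrow ℝ ℝ (Fin n) ν ν).map_eq, measureReal_def,
    MeasurableEquiv.map_apply]
  simpa [measureReal_def, MeasurableEquiv.arrowProdEquivProdArrow, Equiv.arrowProdEquivProdArrow]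
    using h

/-- Two distinct coordinates of a finite power of a probability space are independent. -/
theorem measurePreserving_pi_eval_prodMk {ι : Type*} [Fintype ι] {Ω : Type*} [MeasurableSpace Ω]
    (P : Measure Ω) [IsProbabilityMeasure P] {i j : ι} (hij : i ≠ j) :
    MeasurePreserving (fun x : ι → Ω => (x i, x j)) (Measure.pi fun _ => P) (P.prod P) where
  measurable := by fun_prop
  map_eq := by
    rw [← Measure.infinitePi_eq_pi]
    exact Measure.infinitePi_map_eval_prod (P := fun _ : ι => P) hij

/-- If the squared distances from `c` to the points `x i` are at least `r / 2`, and the normalized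
inner products of distinct centred points are below `√2 / 2`, then the points are linearly
separable. -/
theorem linearlySeparable_range_of_inner_lt {n M : ℕ} {x : Fin M → (Fin n → ℝ)} {c : Fin n → ℝ}
    {r : ℝ} (hr : 0 < r) (hx : ∀ j, 1 / 2 ≤ (∑ k, (x j k - c k) ^ 2) / r)
    (hxx : ∀ i j, i ≠ j → (∑ k, ((x i k - c k) / Real.sqrt r) *
      ((x j k - c k) / Real.sqrt (∑ k', (x j k' - c k') ^ 2))) < Real.sqrt 2 / 2) :
    LinearlySeparable (Set.range x) := by
  rintro _ ⟨j, rfl⟩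
  refine ⟨∑ k, (x j k - c k) • LinearMap.proj k, ?_⟩
  rintro _ ⟨i, rfl⟩ hne
  have hij : i ≠ j := fun h => hne (by rw [h])
  have h1 := hx j
  have h2 := hxx i j hij
  set N := ∑ k', (x j k' - c k') ^ 2 with hN
  have hrN : r / 2 ≤ N := by rw [le_div_iff₀ hr] at h1; linarith
  have hN0 : 0 < N := by linarith
  simp_rw [div_mul_div_comm] at h2
  rw [← Finset.sum_div, div_lt_iff₀ (by positivity)] at h2
  have hsq : Real.sqrt 2 / 2 * Real.sqrt r ≤ Real.sqrt N := by
    apply Real.le_sqrt_of_sq_le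
    rw [mul_pow, div_pow, Real.sq_sqrt hr.le, Real.sq_sqrt (by norm_num)]
    linarith
  have h3 : ∑ k, (x i k - c k) * (x j k - c k) < N := by
    calc _ < Real.sqrt 2 / 2 * Real.sqrt r * Real.sqrt N := by rw [mul_assoc]; exact h2
      _ ≤ Real.sqrt N * Real.sqrt N := by gcongr
      _ = N := Real.mul_self_sqrt hN0.le
  have h4 : ∑ k, (x j k - c k) * x i k - ∑ k, (x j k - c k) * x j k =
      ∑ k, (x i k - c k) * (x j k - c k) - N := by
    rw [hN, ← Finset.sum_sub_distrib, ← Finset.sum_sub_distrib]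
    exact Finset.sum_congr rfl fun k _ => by ring
  simp only [LinearMap.sum_apply, LinearMap.smul_apply, LinearMap.proj_apply, smul_eq_mul]
  linarith

/-- (Corollary 2, second part.) Let `μ = ν₁ ⊗ … ⊗ νₙ` be a product
probability measure on `[0,1]ⁿ` with coordinate means `mₖ` and variances `σₖ² > σ₀² > 0`,
`R₀² = Σₖ σₖ²`, let `x₁, …, x_M` be i.i.d. with law `μ` and `0 < ϑ < 1`. If
`(M+1)² < (1/3)ϑ·exp(0.5nσ₀⁴)` then with probability `> 1 - ϑ`:
`1/2 ≤ ‖xⱼ-x̄‖²/R₀² ≤ 3/2` for all `j` and `((xᵢ-x̄)/R₀, (xⱼ-x̄)/‖xⱼ-x̄‖) < √2/2` for all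
`i ≠ j`; in particular `{x₁, …, x_M}` is linearly separable with probability `> 1 - ϑ`. -/
theorem cube_separation_cardinality_all_points
    (n M : ℕ) (hn : 1 ≤ n) (hM : 1 ≤ M)
    (ν : Fin n → Measure ℝ) [∀ k, IsProbabilityMeasure (ν k)]
    (hsupp : ∀ k, ν k (Set.Icc (0 : ℝ) 1)ᶜ = 0)
    (m : Fin n → ℝ) (hm : ∀ k, m k = ∫ t, t ∂(ν k))
    (σ2 : Fin n → ℝ) (hσ2 : ∀ k, σ2 k = ∫ t, (t - m k) ^ 2 ∂(ν k))
    (σ0sq : ℝ) (hσ0pos : 0 < σ0sq) (hvar : ∀ k, σ0sq < σ2 k)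
    (R0sq : ℝ) (hR0 : R0sq = ∑ k, σ2 k)
    (ϑ : ℝ) (hϑ0 : 0 < ϑ) (hϑ1 : ϑ < 1)
    (hcard : ((M : ℝ) + 1) ^ 2 < (1 / 3) * ϑ * Real.exp (0.5 * n * σ0sq ^ 2)) :
    (Measure.pi fun _ : Fin M => Measure.pi ν)
      {x : Fin M → (Fin n → ℝ) |
        (∀ j, 1 / 2 ≤ (∑ k, (x j k - m k) ^ 2) / R0sq ∧
              (∑ k, (x j k - m k) ^ 2) / R0sq ≤ 3 / 2) ∧
        ∀ i j, i ≠ j →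
          (∑ k, ((x i k - m k) / Real.sqrt R0sq) *
              ((x j k - m k) / Real.sqrt (∑ k', (x j k' - m k') ^ 2)))
            < Real.sqrt 2 / 2}
      > ENNReal.ofReal (1 - ϑ) ∧
    (Measure.pi fun _ : Fin M => Measure.pi ν)
      {x : Fin M → (Fin n → ℝ) | LinearlySeparable (Set.range x)}
      > ENNReal.ofReal (1 - ϑ) := by
  have hsupp' : ∀ k, ∀ᵐ t ∂(ν k), t ∈ Set.Icc (0 : ℝ) 1 := fun k => mem_ae_iff.2 (hsupp k)
  have hm01 : ∀ k, m k ∈ Set.Icc (0 : ℝ) 1 := fun k => by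
    have hint : Integrable (fun t : ℝ => t) (ν k) :=
      Integrable.of_mem_Icc 0 1 aemeasurable_id (hsupp' k)
    rw [hm k]
    constructor
    · exact integral_nonneg_of_ae ((hsupp' k).mono fun t ht => ht.1)
    · simpa using integral_mono_ae hint (integrable_const (1 : ℝ)) ((hsupp' k).mono fun t ht => ht.2)
  have hn0 : (0 : ℝ) < n := by exact_mod_cast hn
  have hRn : n * σ0sq ≤ R0sq := by
    rw [hR0]
    simpa using Finset.sum_le_sum (s := Finset.univ) fun k _ => (hvar k).le
  have hRpos : 0 < R0sq := (mul_pos hn0 hσ0pos).trans_le hRn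
  set P := Measure.pi ν
  set Q := Measure.pi fun _ : Fin M => P
  set δ := Real.exp (-(0.5 * n * σ0sq ^ 2)) with hδ
  have hδ0 : 0 < δ := Real.exp_pos _
  have htail : Real.exp (-(2 * (R0sq / 2) ^ 2 / n)) ≤ δ := by
    rw [hδ, Real.exp_le_exp, neg_le_neg_iff, le_div_iff₀ hn0]
    have := pow_le_pow_left₀ (mul_pos hn0 hσ0pos).le hRn 2
    linarith
  have hcardδ : ((M : ℝ) + 1) ^ 2 * δ < ϑ := by
    have h := mul_lt_mul_of_pos_right hcard hδ0
    rw [mul_assoc, hδ, ← Real.exp_add, add_neg_cancel, Real.exp_zero] at h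
    rw [hδ]
    linarith
  obtain ⟨hup, hdn⟩ := measureReal_pi_sum_sq_sub_ge_le ν hsupp' m hm01 σ2 hσ2
    (ε := R0sq / 2) (by positivity)
  have hpair := measureReal_prod_sum_mul_ge_le ν hsupp' m hm hm01 (ε := R0sq / 2) (by positivity)
  rw [← hR0] at hup hdn
  let far (j : Fin M) : Set (Fin M → Fin n → ℝ) :=
    {x | R0sq / 2 ≤ ∑ k, (x j k - m k) ^ 2 - R0sq}
  let near (j : Fin M) : Set (Fin M → Fin n → ℝ) :=
    {x | R0sq / 2 ≤ R0sq - ∑ k, (x j k - m k) ^ 2}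
  let aligned (i j : Fin M) : Set (Fin M → Fin n → ℝ) :=
    {x | i ≠ j ∧ R0sq / 2 ≤ ∑ k, (x i k - m k) * (x j k - m k)}
  have hfar : ∀ j, Q.real (far j) ≤ δ := fun j => by
    refine le_trans (le_of_eq ?_) (hup.trans htail)
    have hmeas : MeasurableSet {y : Fin n → ℝ | R0sq / 2 ≤ ∑ k, (y k - m k) ^ 2 - R0sq} :=
      measurableSet_le (by fun_prop) (by fun_prop)
    exact (measurePreserving_eval (fun _ : Fin M => P) j).measureReal_preimage
      hmeas.nullMeasurableSet
  have hnear : ∀ j, Q.real (near j) ≤ δ := fun j => by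
    refine le_trans (le_of_eq ?_) (hdn.trans htail)
    have hmeas : MeasurableSet {y : Fin n → ℝ | R0sq / 2 ≤ R0sq - ∑ k, (y k - m k) ^ 2} :=
      measurableSet_le (by fun_prop) (by fun_prop)
    exact (measurePreserving_eval (fun _ : Fin M => P) j).measureReal_preimage
      hmeas.nullMeasurableSet
  have haligned : ∀ i j, Q.real (aligned i j) ≤ δ := fun i j => by
    by_cases hij : i = j
    · simpa [aligned, hij] using hδ0.le
    · refine le_trans (le_of_eq ?_) (hpair.trans htail)
      rw [← (measurePreserving_pi_eval_prodMk P hij).measureReal_preimage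
        (measurableSet_le (by fun_prop) (by fun_prop)).nullMeasurableSet]
      simp [aligned, hij, Q]
  let bad : Set (Fin M → Fin n → ℝ) := (⋃ j, far j) ∪ (⋃ j, near j) ∪ ⋃ i, ⋃ j, aligned i j
  have hbad : Q.real bad < ϑ := by
    have hunion : ∀ s : Fin M → Set (Fin M → Fin n → ℝ), ∀ b, (∀ j, Q.real (s j) ≤ b) →
        Q.real (⋃ j, s j) ≤ M * b := fun s b hs => by
      refine (measureReal_iUnion_fintype_le s).trans ((Finset.sum_le_sum fun j _ => hs j).trans ?_)
      simp
    have h1 := hunion far δ hfar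
    have h2 := hunion near δ hnear
    have h3 := hunion (fun i => ⋃ j, aligned i j) (M * δ) fun i => hunion _ δ (haligned i)
    have h4 := measureReal_union_le (μ := Q) ((⋃ j, far j) ∪ ⋃ j, near j) (⋃ i, ⋃ j, aligned i j)
    have h5 := measureReal_union_le (μ := Q) (⋃ j, far j) (⋃ j, near j)
    calc Q.real bad ≤ M * δ + M * δ + M * (M * δ) := by linarith
      _ ≤ ((M : ℝ) + 1) ^ 2 * δ := by linarith
      _ < ϑ := hcardδ
  have hlarge : ∀ S : Set (Fin M → Fin n → ℝ), badᶜ ⊆ S → Q S > ENNReal.ofReal (1 - ϑ) := by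
    intro S hS
    have h1 : (1 : ℝ) ≤ Q.real S + Q.real bad := by
      have hcov : S ∪ bad = Set.univ := by
        rw [Set.eq_univ_iff_forall]
        intro x
        by_cases hx : x ∈ bad
        · exact Or.inr hx
        · exact Or.inl (hS hx)
      have h := measureReal_union_le (μ := Q) S bad
      rwa [hcov, probReal_univ] at h
    rw [gt_iff_lt, ENNReal.ofReal_lt_iff_lt_toReal (by linarith) (measure_ne_top _ _)]
    change 1 - ϑ < Q.real S
    linarith
  have hgood : badᶜ ⊆ {x : Fin M → (Fin n → ℝ) |
        (∀ j, 1 / 2 ≤ (∑ k, (x j k - m k) ^ 2) / R0sq ∧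
              (∑ k, (x j k - m k) ^ 2) / R0sq ≤ 3 / 2) ∧
        ∀ i j, i ≠ j →
          (∑ k, ((x i k - m k) / Real.sqrt R0sq) *
              ((x j k - m k) / Real.sqrt (∑ k', (x j k' - m k') ^ 2)))
            < Real.sqrt 2 / 2} := by
    intro x hx
    simp only [bad, far, near, aligned, Set.mem_compl_iff, Set.mem_union, Set.mem_iUnion,
      Set.mem_ofPred_eq, not_or, not_exists, not_and, not_le] at hx
    obtain ⟨⟨hx1, hx2⟩, hx3⟩ := hx
    refine ⟨fun j => ⟨?_, ?_⟩, fun i j hij => ?_⟩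
    · rw [le_div_iff₀ hRpos]; linarith [hx2 j]
    · rw [div_le_iff₀ hRpos]; linarith [hx1 j]
    · set N := ∑ k', (x j k' - m k') ^ 2 with hN
      have hRN : R0sq / 2 ≤ N := by linarith [hx2 j]
      have hN0 : 0 < N := by linarith
      simp_rw [div_mul_div_comm]
      rw [← Finset.sum_div, div_lt_iff₀ (by positivity)]
      refine (hx3 i j hij).trans_le ?_
      have hsq : Real.sqrt R0sq ≤ Real.sqrt 2 * Real.sqrt N := by
        rw [← Real.sqrt_mul (by norm_num)]
        exact Real.sqrt_le_sqrt (by linarith)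
      calc R0sq / 2 = Real.sqrt R0sq * Real.sqrt R0sq / 2 := by rw [Real.mul_self_sqrt hRpos.le]
        _ ≤ Real.sqrt R0sq * (Real.sqrt 2 * Real.sqrt N) / 2 := by gcongr
        _ = _ := by ring
  exact ⟨hlarge _ hgood, hlarge _ fun x hx => linearlySeparable_range_of_inner_lt hRpos
    (fun j => ((hgood hx).1 j).1) (hgood hx).2⟩
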